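/- Let ε ∈ (0, 1), let π* = ε^{ε/(1-ε)} / (1 + (1-ε)·ε^{ε/(1-ε)}), and let b ∈ [0, (1-ε)π*]. Then the supremum of f(π) = H₂(π(1-ε)) − π·H₂(ε) over all π ∈ [0,1] satisfying π(1-ε) ≥ b equals log₂(1 − ε^{1/(1-ε)} + ε^{ε/(1-ε)}). (This is the information-energy capacity function C(b) of the Z-channel in the regime where the energy constraint is vacuous: the unconstrained capacity-achieving input remains feasible.) -/

import Mathlib

/-- The binary entropy function `H₂(x) = -x·log₂ x - (1-x)·log₂(1-x)`,
with the convention `0·log₂ 0 = 0` (automatic since `Real.logb 2 0 = 0`). -/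
noncomputable def binEnt (x : ℝ) : ℝ :=
  -x * Real.logb 2 x - (1 - x) * Real.logb 2 (1 - x)

/-- Pointwise Gibbs inequality. -/
lemma mul_log_sub_log_le {p q : ℝ} (hp : 0 ≤ p) (hq : 0 < q) :
    p * (Real.log q - Real.log p) ≤ q - p := by
  rcases hp.eq_or_lt with rfl | hp
  · simpa using hq.le
  · rw [← Real.log_div hq.ne' hp.ne']
    have h := mul_le_mul_of_nonneg_left (Real.log_le_sub_one_of_pos (div_pos hq hp)) hp.le
    have e : p * (q / p - 1) = q - p := by field_simp
    exact h.trans_eq e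

lemma binEnt_eq_log (x : ℝ) :
    binEnt x = (-x * Real.log x - (1 - x) * Real.log (1 - x)) / Real.log 2 := by
  simp only [binEnt, Real.logb]
  ring

lemma binEnt_add_mul_logb_le {p c : ℝ} (hp : 0 ≤ p) (hp1 : p ≤ 1) (hc : 0 < c) :
    binEnt p + p * Real.logb 2 c ≤ Real.logb 2 (1 + c) := by
  have hD : 0 < 1 + c := by linarith
  have h1 := mul_log_sub_log_le hp (div_pos hc hD)
  have h2 := mul_log_sub_log_le (sub_nonneg.2 hp1) (div_pos one_pos hD)
  rw [Real.log_div hc.ne' hD.ne'] at h1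
  rw [Real.log_div one_ne_zero hD.ne', Real.log_one] at h2
  have e : c / (1 + c) + 1 / (1 + c) = 1 := by field_simp; ring
  have h : -p * Real.log p - (1 - p) * Real.log (1 - p) + p * Real.log c
      ≤ Real.log (1 + c) := by linarith
  have h' := div_le_div_of_nonneg_right h (Real.log_pos one_lt_two).le
  rw [add_div, mul_div_assoc] at h'
  rwa [binEnt_eq_log]

lemma binEnt_add_mul_logb_eq {c : ℝ} (hc : 0 < c) :
    binEnt (c / (1 + c)) + c / (1 + c) * Real.logb 2 c = Real.logb 2 (1 + c) := by
  have hD : 0 < 1 + c := by linarith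
  have e : 1 - c / (1 + c) = 1 / (1 + c) := by field_simp; ring
  rw [binEnt, e, Real.logb_div hc.ne' hD.ne', Real.logb_div one_ne_zero hD.ne', Real.logb_one]
  field_simp
  ring

lemma binEnt_eq_neg_mul_logb {ε : ℝ} (hε : ε ∈ Set.Ioo (0 : ℝ) 1) :
    binEnt ε = -((1 - ε) * Real.logb 2 ((1 - ε) * ε ^ (ε / (1 - ε)))) := by
  obtain ⟨h0, h1⟩ := hε
  have ha : 0 < 1 - ε := by linarith
  rw [Real.logb_mul ha.ne' (Real.rpow_pos_of_pos h0 _).ne', Real.logb_rpow_eq_mul_logb_of_pos h0,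
    binEnt]
  field_simp
  ring

/-- For `ε ∈ (0,1)`, `π* = ε^{ε/(1-ε)}/(1 + (1-ε)·ε^{ε/(1-ε)})` and `b ∈ [0, (1-ε)π*]`,
the supremum of the Z-channel mutual information `f(π) = H₂(π(1-ε)) - π·H₂(ε)` over all
`π ∈ [0,1]` with energy rate `π(1-ε) ≥ b` equals `log₂(1 - ε^{1/(1-ε)} + ε^{ε/(1-ε)})`
(information-energy capacity function of the Z-channel in the vacuous-constraint regime). -/
theorem z_channel_capacity_vacuous (ε b : ℝ) (hε : ε ∈ Set.Ioo (0 : ℝ) 1)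
    (hb : b ∈ Set.Icc (0 : ℝ)
      ((1 - ε) * (ε ^ (ε / (1 - ε)) / (1 + (1 - ε) * ε ^ (ε / (1 - ε)))))) :
    sSup {y : ℝ | ∃ π ∈ Set.Icc (0 : ℝ) 1,
        b ≤ π * (1 - ε) ∧ y = binEnt (π * (1 - ε)) - π * binEnt ε} =
      Real.logb 2 (1 - ε ^ (1 / (1 - ε)) + ε ^ (ε / (1 - ε))) := by
  have h0 := hε.1
  have ha : 0 < 1 - ε := sub_pos.2 hε.2
  have hent := binEnt_eq_neg_mul_logb hε
  have hpow : ε ^ (1 / (1 - ε)) = ε * ε ^ (ε / (1 - ε)) := by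
    rw [← Real.rpow_one_add' h0.le (by positivity)]
    congr 1
    field_simp
    ring
  have ht : 0 < ε ^ (ε / (1 - ε)) := Real.rpow_pos_of_pos h0 _
  have ht1 : ε ^ (ε / (1 - ε)) ≤ 1 := Real.rpow_le_one h0.le hε.2.le (by positivity)
  rw [hpow]
  set t := ε ^ (ε / (1 - ε))
  have hc : 0 < (1 - ε) * t := mul_pos ha ht
  have hD : 0 < 1 + (1 - ε) * t := by linarith
  have hval : 1 - ε * t + t = 1 + (1 - ε) * t := by ring
  have hobj (x : ℝ) : binEnt (x * (1 - ε)) - x * binEnt ε =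
      binEnt (x * (1 - ε)) + x * (1 - ε) * Real.logb 2 ((1 - ε) * t) := by
    rw [hent]
    ring
  rw [hval]
  apply IsGreatest.csSup_eq
  constructor
  · have hp : t / (1 + (1 - ε) * t) * (1 - ε) = (1 - ε) * t / (1 + (1 - ε) * t) := by ring
    refine ⟨t / (1 + (1 - ε) * t), ⟨by positivity, ?_⟩, ?_, ?_⟩
    · rw [div_le_one hD]
      nlinarith [hε.2]
    · rw [mul_comm]
      exact hb.2
    · rw [hobj, hp, binEnt_add_mul_logb_eq hc]
  · rintro y ⟨x, ⟨hx0, hx1⟩, -, rfl⟩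
    rw [hobj]
    exact binEnt_add_mul_logb_le (mul_nonneg hx0 ha.le) (by nlinarith) hc
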